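/- arXiv:2407.21116 — 4 statements merged into one kernel-verified Lean document; each statement's English description precedes it below -/
import Mathlib

section
/- Let n ≥ 1 and let π be a permutation of {1,…,n}. Then π is 321-avoiding if and only if there exists a function x : {1,…,n} → ℝ such that for every pair of indices i < j with π(i) > π(j) one has x(j) − x(i) = 1. -/
/-- A permutation `π` of `{1,…,n}` (modeled as `Fin n`) is 321-avoiding if there are
no indices `i < j < k` with `π i > π j > π k`. -/
def Is321Avoiding {n : ℕ} (π : Equiv.Perm (Fin n)) : Prop :=
  ¬ ∃ i j k : Fin n, i < j ∧ j < k ∧ π j < π i ∧ π k < π j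

/-- For `n ≥ 1` and a permutation `π` of `{1,…,n}`, `π` is 321-avoiding
if and only if there exists `x : {1,…,n} → ℝ` such that for every inversion `i < j`
(i.e. `π i > π j`) one has `x j - x i = 1`. -/
theorem avoiding321_iff_exists_real_weight (n : ℕ) (hn : 1 ≤ n) (π : Equiv.Perm (Fin n)) :
    Is321Avoiding π ↔
      ∃ x : Fin n → ℝ, ∀ i j : Fin n, i < j → π j < π i → x j - x i = 1 := by
  classical
  constructor
  · intro h
    refine ⟨fun j => if ∃ i, i < j ∧ π j < π i then 1 else 0, ?_⟩
    intro i j hij hp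
    have h1 : ∃ i, i < j ∧ π j < π i := ⟨i, hij, hp⟩
    have h2 : ¬ ∃ k, k < i ∧ π i < π k := by
      rintro ⟨k, hk, hk2⟩
      exact h ⟨k, i, j, hk, hij, hk2, hp⟩
    simp only [if_pos h1, if_neg h2, sub_zero]
  · rintro ⟨x, hx⟩ ⟨i, j, k, hij, hjk, h1, h2⟩
    have a := hx i j hij h1
    have b := hx j k hjk h2
    have c := hx i k (hij.trans hjk) (h2.trans h1)
    linarith
end

section
/- Let n ≥ 1 and let g : ℤ → ℤ be an affine permutation of period n, i.e. a bijection satisfying g(i+n) = g(i) + n for all i ∈ ℤ. Then g is 321-avoiding if and only if there exists a function x : ℤ → ℝ with x(i+n) = x(i) for all i, such that for every pair of integers i < j with g(i) > g(j) one has x(j) − x(i) = 1. -/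
/-- Let `n ≥ 1` and let `g : ℤ → ℤ` be an affine permutation of period `n`,
i.e. a bijection with `g (i + n) = g i + n` for all `i`. Then `g` is 321-avoiding
(there are no integers `i < j < k` with `g i > g j > g k`) if and only if there exists
an `n`-periodic function `x : ℤ → ℝ` such that for every pair `i < j` with `g i > g j`
one has `x j - x i = 1`. -/
theorem affine_avoiding321_iff_exists_real_weight (n : ℕ) (hn : 1 ≤ n) (g : ℤ → ℤ)
    (hbij : Function.Bijective g) (hper : ∀ i : ℤ, g (i + n) = g i + n) :
    (¬ ∃ i j k : ℤ, i < j ∧ j < k ∧ g j < g i ∧ g k < g j) ↔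
      ∃ x : ℤ → ℝ, (∀ i : ℤ, x (i + n) = x i) ∧
        ∀ i j : ℤ, i < j → g j < g i → x j - x i = 1 := by
  constructor
  · intro h
    classical
    refine ⟨fun j => if ∃ a, a < j ∧ g j < g a then 1 else 0, ?_, ?_⟩
    · intro i
      have e : (∃ a, a < i + (n : ℤ) ∧ g (i + n) < g a) ↔ ∃ a, a < i ∧ g i < g a := by
        constructor
        · rintro ⟨a, h1, h2⟩
          have h3 := hper (a - n)
          rw [sub_add_cancel] at h3
          have h4 := hper i
          exact ⟨a - n, by omega, by omega⟩
        · rintro ⟨a, h1, h2⟩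
          have h3 := hper a
          have h4 := hper i
          exact ⟨a + n, by omega, by omega⟩
      simp only [e]
    · intro i j hij hg
      have h1 : ∃ a, a < j ∧ g j < g a := ⟨i, hij, hg⟩
      have h2 : ¬ ∃ a, a < i ∧ g i < g a := by
        rintro ⟨a, ha, hb⟩
        exact h ⟨a, i, j, ha, hij, hb, hg⟩
      simp only [if_pos h1, if_neg h2, sub_zero]
  · rintro ⟨x, -, hx⟩ ⟨i, j, k, hij, hjk, h1, h2⟩
    have a := hx i j hij h1
    have b := hx j k hjk h2
    have c := hx i k (hij.trans hjk) (h2.trans h1)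
    linarith
end

section
/- Let n ≥ 2 and let π be a permutation of {1,…,n}. Then π is 321-avoiding if and only if any two reduced words for π can be obtained from each other by a finite sequence of commutation moves (i.e. π has a unique reduced word up to commuting moves). -/
/-- The simple transposition of the symmetric group on `Fin n` exchanging the
(0-based) positions `i` and `i+1`; it is the identity if `i+1 ≥ n`.  (With 1-based
labels `1,…,n` this is the transposition `s_{i+1}` exchanging `i+1` and `i+2`.) -/
def simpleTransposition (n : ℕ) (i : ℕ) : Equiv.Perm (Fin n) :=
  if h : i + 1 < n then Equiv.swap ⟨i, Nat.lt_of_succ_lt h⟩ ⟨i + 1, h⟩ else 1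

/-- The number of inversions of a permutation of `Fin n`: pairs `i < j` with `π i > π j`.
This equals the Coxeter length of `π`. -/
def invCount {n : ℕ} (π : Equiv.Perm (Fin n)) : ℕ :=
  (Finset.univ.filter (fun p : Fin n × Fin n => p.1 < p.2 ∧ π p.2 < π p.1)).card

/-- `w` is a reduced word for `π`: a list of (0-based) indices of simple transpositions
whose product is `π` and whose length is the Coxeter length (number of inversions) of `π`. -/
def IsReducedWord (n : ℕ) (π : Equiv.Perm (Fin n)) (w : List ℕ) : Prop :=
  (∀ i ∈ w, i + 1 < n) ∧ (w.map (simpleTransposition n)).prod = π ∧ w.length = invCount π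

/-- A single commutation move: exchange two adjacent entries `x, y` of a word with
`|x - y| ≥ 2`. -/
def CommMove (w w' : List ℕ) : Prop :=
  ∃ l₁ l₂ : List ℕ, ∃ x y : ℕ,
    w = l₁ ++ x :: y :: l₂ ∧ w' = l₁ ++ y :: x :: l₂ ∧ (x + 2 ≤ y ∨ y + 2 ≤ x)

theorem st_val {n i : ℕ} (h : i + 1 < n) (a : Fin n) :
    (simpleTransposition n i a).val = if a.val = i then i + 1 else if a.val = i + 1 then i else a.val := by
  unfold simpleTransposition
  rw [dif_pos h, Equiv.swap_apply_def]
  simp only [Fin.ext_iff]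
  split_ifs <;> rfl

theorem st_st {n i : ℕ} (a : Fin n) : simpleTransposition n i (simpleTransposition n i a) = a := by
  unfold simpleTransposition
  split_ifs <;> simp

theorem st_mul_st (n i : ℕ) : simpleTransposition n i * simpleTransposition n i = 1 := by
  ext a; simp [st_st]

theorem mul_st_st {n : ℕ} (π : Equiv.Perm (Fin n)) (i : ℕ) :
    π * simpleTransposition n i * simpleTransposition n i = π := by
  rw [mul_assoc, st_mul_st, mul_one]

theorem st_lt {n i : ℕ} (h : i + 1 < n) {a b : Fin n} (hab : a < b)
    (hne : ¬ (a.val = i ∧ b.val = i + 1)) :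
    simpleTransposition n i a < simpleTransposition n i b := by
  rw [Fin.lt_def] at *
  rw [st_val h, st_val h]
  split_ifs <;> omega

theorem st_left {n i : ℕ} (h : i + 1 < n) :
    simpleTransposition n i ⟨i, Nat.lt_of_succ_lt h⟩ = ⟨i + 1, h⟩ := by
  apply Fin.ext; rw [st_val h]; simp

theorem st_right {n i : ℕ} (h : i + 1 < n) :
    simpleTransposition n i ⟨i + 1, h⟩ = ⟨i, Nat.lt_of_succ_lt h⟩ := by
  apply Fin.ext; rw [st_val h]; simp

def Desc {n : ℕ} (π : Equiv.Perm (Fin n)) (i : ℕ) : Prop :=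
  ∃ h : i + 1 < n, π ⟨i + 1, h⟩ < π ⟨i, Nat.lt_of_succ_lt h⟩

theorem invCount_asc {n i : ℕ} (π : Equiv.Perm (Fin n)) (h : i + 1 < n)
    (hlt : π ⟨i, Nat.lt_of_succ_lt h⟩ < π ⟨i + 1, h⟩) :
    invCount (π * simpleTransposition n i) = invCount π + 1 := by
  unfold invCount
  set s := simpleTransposition n i with hs
  set A := Finset.univ.filter (fun p : Fin n × Fin n => p.1 < p.2 ∧ π p.2 < π p.1) with hA
  have key : Finset.univ.filter (fun p : Fin n × Fin n => p.1 < p.2 ∧ (π * s) p.2 < (π * s) p.1)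
      = insert (⟨i, Nat.lt_of_succ_lt h⟩, ⟨i + 1, h⟩)
        (A.map (Equiv.prodCongr s s).toEmbedding) := by
    ext ⟨a, b⟩
    rw [Finset.mem_filter]
    simp only [Finset.mem_filter, Finset.mem_univ, true_and, Finset.mem_insert, Finset.mem_map,
      Equiv.Perm.mul_apply, hA, Prod.exists, Equiv.coe_toEmbedding, Equiv.prodCongr_apply,
      Prod.map_apply, Prod.mk.injEq]
    constructor
    · rintro ⟨h1, h2⟩
      by_cases hc : a.val = i ∧ b.val = i + 1
      · left; exact ⟨Fin.ext hc.1, Fin.ext hc.2⟩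
      · right
        exact ⟨s a, s b, ⟨st_lt h h1 hc, h2⟩, st_st a, st_st b⟩
    · rintro (⟨rfl, rfl⟩ | ⟨c, d, ⟨h1, h2⟩, rfl, rfl⟩)
      · refine ⟨by simp [Fin.lt_def], ?_⟩
        rw [hs, st_left, st_right]; exact hlt
      · rw [hs, st_st, st_st]
        refine ⟨st_lt h h1 ?_, h2⟩
        rintro ⟨hc, hd⟩
        have e1 : c = ⟨i, Nat.lt_of_succ_lt h⟩ := Fin.ext hc
        have e2 : d = ⟨i + 1, h⟩ := Fin.ext hd
        subst e1 e2
        exact lt_asymm hlt h2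
  rw [key, Finset.card_insert_of_notMem, Finset.card_map]
  simp only [Finset.mem_map, hA, Finset.mem_filter, Finset.mem_univ, true_and, Prod.exists,
    Equiv.coe_toEmbedding, Equiv.prodCongr_apply, Prod.map_apply, Prod.mk.injEq]
  rintro ⟨c, d, ⟨h1, h2⟩, h3, h4⟩
  have e1 : c = ⟨i + 1, h⟩ := by rw [← st_left h, ← h3, hs, st_st]
  have e2 : d = ⟨i, Nat.lt_of_succ_lt h⟩ := by rw [← st_right h, ← h4, hs, st_st]
  subst e1 e2
  simp [Fin.lt_def] at h1

theorem invCount_desc {n i : ℕ} (π : Equiv.Perm (Fin n)) (hd : Desc π i) :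
    invCount (π * simpleTransposition n i) + 1 = invCount π := by
  obtain ⟨h, hlt⟩ := hd
  have := invCount_asc (π * simpleTransposition n i) h (by
    simp only [Equiv.Perm.mul_apply]
    rw [st_left h, st_right h]; exact hlt)
  rw [mul_st_st] at this
  exact this.symm

theorem asc_of_not_desc {n i : ℕ} {π : Equiv.Perm (Fin n)} (h : i + 1 < n) (hd : ¬ Desc π i) :
    π ⟨i, Nat.lt_of_succ_lt h⟩ < π ⟨i + 1, h⟩ := by
  by_contra hc
  refine hd ⟨h, lt_of_le_of_ne (not_lt.mp hc) ?_⟩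
  intro he
  have := π.injective he
  simp at this

theorem invCount_le {n : ℕ} (π : Equiv.Perm (Fin n)) (i : ℕ) (h : i + 1 < n) :
    invCount (π * simpleTransposition n i) ≤ invCount π + 1 := by
  by_cases hd : Desc π i
  · have := invCount_desc π hd; omega
  · exact (invCount_asc π h (asc_of_not_desc h hd)).le

theorem invCount_one (n : ℕ) : invCount (1 : Equiv.Perm (Fin n)) = 0 := by
  unfold invCount
  rw [Finset.card_eq_zero, Finset.filter_eq_empty_iff]
  rintro ⟨a, b⟩ _ ⟨h1, h2⟩
  exact lt_asymm h1 h2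

theorem invCount_prod_le {n : ℕ} (w : List ℕ) (hw : ∀ i ∈ w, i + 1 < n) :
    invCount (w.map (simpleTransposition n)).prod ≤ w.length := by
  induction w using List.reverseRecOn with
  | nil => simp [invCount_one]
  | append_singleton l a ih =>
    have h1 := ih (fun i hi => hw i (by simp [hi]))
    have h2 := invCount_le (l.map (simpleTransposition n)).prod a (hw a (by simp))
    simp only [List.map_append, List.prod_append, List.map_cons, List.map_nil, List.prod_singleton,
      List.length_append, List.length_singleton]
    omega

/-- a descent in between -/
theorem exists_desc {n : ℕ} (π : Equiv.Perm (Fin n)) (a : Fin n) (d : ℕ) (hb : a.val + d < n)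
    (hlt : π ⟨a.val + d, hb⟩ < π a) : ∃ i, Desc π i ∧ a.val ≤ i ∧ i + 1 ≤ a.val + d := by
  induction d with
  | zero => exact absurd hlt (lt_irrefl _)
  | succ d ih =>
    by_cases hd : Desc π (a.val + d)
    · exact ⟨_, hd, by omega, by omega⟩
    · have h1 := asc_of_not_desc (show a.val + d + 1 < n by omega) hd
      obtain ⟨i, h2, h3, h4⟩ := ih (by omega) (lt_trans h1 hlt)
      exact ⟨i, h2, h3, by omega⟩

theorem exists_desc' {n : ℕ} (π : Equiv.Perm (Fin n)) {a b : Fin n} (hab : a < b)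
    (hlt : π b < π a) : ∃ i, Desc π i ∧ a.val ≤ i ∧ i + 1 ≤ b.val := by
  have hab' : a.val < b.val := hab
  have e : b = ⟨a.val + (b.val - a.val), by omega⟩ := Fin.ext (by simp; omega)
  rw [e] at hlt
  obtain ⟨i, h1, h2, h3⟩ := exists_desc π a (b.val - a.val) (by omega) hlt
  exact ⟨i, h1, h2, by omega⟩

theorem eq_one_of_invCount {n : ℕ} (π : Equiv.Perm (Fin n)) (h : invCount π = 0) : π = 1 := by
  have hm : StrictMono π := by
    intro a b hab
    by_contra hc
    have hlt : π b < π a := lt_of_le_of_ne (not_lt.mp hc) (fun he => hab.ne' (π.injective he))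
    unfold invCount at h
    rw [Finset.card_eq_zero, Finset.filter_eq_empty_iff] at h
    exact h (Finset.mem_univ (a, b)) ⟨hab, hlt⟩
  ext a
  have : (hm.orderIsoOfSurjective _ π.surjective) = OrderIso.refl _ := Subsingleton.elim _ _
  have h2 := congrArg (fun f => f a) this
  have h3 : π a = a := by simpa using h2
  simp [h3]

theorem exists_desc_of_pos {n : ℕ} (π : Equiv.Perm (Fin n)) (h : 0 < invCount π) :
    ∃ i, Desc π i := by
  obtain ⟨⟨a, b⟩, hp⟩ := Finset.card_pos.mp h
  simp only [Finset.mem_filter] at hp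
  obtain ⟨i, hi, _⟩ := exists_desc' π hp.2.1 hp.2.2
  exact ⟨i, hi⟩

theorem red_append {n i : ℕ} {π : Equiv.Perm (Fin n)} {v : List ℕ} (hd : Desc π i)
    (hv : IsReducedWord n (π * simpleTransposition n i) v) : IsReducedWord n π (v ++ [i]) := by
  obtain ⟨h1, h2, h3⟩ := hv
  refine ⟨?_, ?_, ?_⟩
  · intro j hj
    simp only [List.mem_append, List.mem_singleton] at hj
    rcases hj with hj | rfl
    · exact h1 j hj
    · exact hd.1
  · simp only [List.map_append, List.prod_append, List.map_cons, List.map_nil, List.prod_singleton]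
    rw [h2, mul_st_st]
  · rw [List.length_append, h3, List.length_singleton, invCount_desc π hd]

theorem red_of_append {n i : ℕ} {π : Equiv.Perm (Fin n)} {v : List ℕ}
    (hv : IsReducedWord n π (v ++ [i])) :
    Desc π i ∧ IsReducedWord n (π * simpleTransposition n i) v := by
  obtain ⟨h1, h2, h3⟩ := hv
  have hv' : ∀ j ∈ v, j + 1 < n := fun j hj => h1 j (by simp [hj])
  have hi : i + 1 < n := h1 i (by simp)
  simp only [List.map_append, List.prod_append, List.map_cons, List.map_nil, List.prod_singleton,
    List.length_append, List.length_singleton] at h2 h3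
  have h4 : (v.map (simpleTransposition n)).prod = π * simpleTransposition n i := by
    rw [← h2, mul_st_st]
  have h5 := invCount_prod_le v hv'
  rw [h4] at h5
  have hd : Desc π i := by
    by_contra hd
    have := invCount_asc π hi (asc_of_not_desc hi hd)
    omega
  have h6 := invCount_desc π hd
  exact ⟨hd, hv', h4, by omega⟩

theorem exists_red {n : ℕ} (π : Equiv.Perm (Fin n)) : ∃ w, IsReducedWord n π w := by
  induction hk : invCount π generalizing π with
  | zero =>
    exact ⟨[], by simp, by simp [eq_one_of_invCount π hk], by simp [hk]⟩
  | succ k ih =>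
    obtain ⟨i, hi⟩ := exists_desc_of_pos π (by omega)
    have := invCount_desc π hi
    obtain ⟨v, hv⟩ := ih (π * simpleTransposition n i) (by omega)
    exact ⟨_, red_append hi hv⟩

theorem avoid_desc {n i : ℕ} {π : Equiv.Perm (Fin n)} (hd : Desc π i) (ha : Is321Avoiding π) :
    Is321Avoiding (π * simpleTransposition n i) := by
  rintro ⟨a, b, c, hab, hbc, h1, h2⟩
  simp only [Equiv.Perm.mul_apply] at h1 h2
  obtain ⟨h, hlt⟩ := hd
  have aux : ∀ x y : Fin n, x < y → π (simpleTransposition n i y) < π (simpleTransposition n i x) →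
      simpleTransposition n i x < simpleTransposition n i y := by
    intro x y hxy hp
    apply st_lt h hxy
    rintro ⟨hx, hy⟩
    have e1 : x = ⟨i, Nat.lt_of_succ_lt h⟩ := Fin.ext hx
    have e2 : y = ⟨i + 1, h⟩ := Fin.ext hy
    subst e1 e2
    rw [st_left h, st_right h] at hp
    exact lt_asymm hlt hp
  exact ha ⟨_, _, _, aux a b hab h1, aux b c hbc h2, h1, h2⟩

theorem st_comm {n i j : ℕ} (hi : i + 1 < n) (hj : j + 1 < n) (hij : i + 2 ≤ j ∨ j + 2 ≤ i) :
    simpleTransposition n i * simpleTransposition n j =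
    simpleTransposition n j * simpleTransposition n i := by
  ext a
  simp only [Equiv.Perm.mul_apply, st_val hi, st_val hj]
  split_ifs <;> omega

theorem st_braid {n i : ℕ} (hi : i + 1 + 1 < n) :
    simpleTransposition n i * simpleTransposition n (i + 1) * simpleTransposition n i =
    simpleTransposition n (i + 1) * simpleTransposition n i * simpleTransposition n (i + 1) := by
  have hi' : i + 1 < n := by omega
  ext a
  simp only [Equiv.Perm.mul_apply, st_val hi, st_val hi']
  split_ifs <;> omega

theorem st_fix {n i : ℕ} (h : i + 1 < n) (a : Fin n) (h1 : a.val ≠ i) (h2 : a.val ≠ i + 1) :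
    simpleTransposition n i a = a := by
  apply Fin.ext; rw [st_val h]; simp [h1, h2]

theorem desc_far {n i j : ℕ} {π : Equiv.Perm (Fin n)} (hi : i + 1 < n) (hj : Desc π j)
    (hij : i + 2 ≤ j ∨ j + 2 ≤ i) : Desc (π * simpleTransposition n i) j := by
  obtain ⟨h, hlt⟩ := hj
  refine ⟨h, ?_⟩
  simp only [Equiv.Perm.mul_apply]
  rw [st_fix hi _ (by simp; omega) (by simp; omega), st_fix hi _ (by simp; omega) (by simp; omega)]
  exact hlt

theorem comm_append {u v : List ℕ} (t : List ℕ) (h : Relation.ReflTransGen CommMove u v) :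
    Relation.ReflTransGen CommMove (u ++ t) (v ++ t) := by
  refine Relation.ReflTransGen.lift (f := fun l => l ++ t) ?_ _ _ h
  rintro a b ⟨l₁, l₂, x, y, rfl, rfl, hxy⟩
  exact ⟨l₁, l₂ ++ t, x, y, by simp, by simp, hxy⟩

theorem comm_perm {u v : List ℕ} (h : Relation.ReflTransGen CommMove u v) : u.Perm v := by
  induction h with
  | refl => exact List.Perm.refl _
  | tail _ h ih =>
    obtain ⟨l₁, l₂, x, y, rfl, rfl, hxy⟩ := h
    exact ih.trans (List.Perm.append_left _ (List.Perm.swap _ _ _))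

theorem desc_adj {n i : ℕ} {π : Equiv.Perm (Fin n)} (h1 : Desc π i) (h2 : Desc π (i + 1)) :
    ¬ Is321Avoiding π := by
  obtain ⟨h, h1⟩ := h1
  obtain ⟨h', h2⟩ := h2
  intro ha
  exact ha ⟨⟨i, by omega⟩, ⟨i + 1, h⟩, ⟨i + 1 + 1, h'⟩, by simp [Fin.lt_def],
    by simp [Fin.lt_def], h1, h2⟩

theorem forward {n : ℕ} (π : Equiv.Perm (Fin n)) (ha : Is321Avoiding π) (w w' : List ℕ)
    (hw : IsReducedWord n π w) (hw' : IsReducedWord n π w') :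
    Relation.ReflTransGen CommMove w w' := by
  induction hk : invCount π generalizing π w w' with
  | zero =>
    have e1 : w = [] := List.length_eq_zero_iff.mp (hw.2.2.trans hk)
    have e2 : w' = [] := List.length_eq_zero_iff.mp (hw'.2.2.trans hk)
    subst e1 e2
    exact Relation.ReflTransGen.refl
  | succ k ih =>
    rcases List.eq_nil_or_concat' w with rfl | ⟨u, i, rfl⟩
    · have := hw.2.2; simp at this; omega
    rcases List.eq_nil_or_concat' w' with rfl | ⟨u', j, rfl⟩
    · have := hw'.2.2; simp at this; omega
    obtain ⟨di, ri⟩ := red_of_append hw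
    obtain ⟨dj, rj⟩ := red_of_append hw'
    have ci := invCount_desc π di
    have cj := invCount_desc π dj
    by_cases hij : i = j
    · subst hij
      exact comm_append _ (ih _ (avoid_desc di ha) _ _ ri rj (by omega))
    by_cases hfar : i + 2 ≤ j ∨ j + 2 ≤ i
    · obtain ⟨v, hv⟩ := exists_red (π * simpleTransposition n i * simpleTransposition n j)
      have dj' := desc_far di.1 dj hfar
      have di' := desc_far dj.1 di hfar.symm
      have r1 := red_append dj' hv
      rw [mul_assoc, st_comm di.1 dj.1 hfar, ← mul_assoc] at hv
      have r2 := red_append di' hv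
      have t1 := comm_append [i] (ih _ (avoid_desc di ha) _ _ ri r1 (by omega))
      have t2 := comm_append [j] (ih _ (avoid_desc dj ha) _ _ r2 rj (by omega))
      refine t1.trans (Relation.ReflTransGen.head ?_ t2)
      exact ⟨v, [], j, i, by simp, by simp, hfar.symm⟩
    · exfalso
      rcases (by omega : j = i + 1 ∨ i = j + 1) with rfl | rfl
      · exact desc_adj di dj ha
      · exact desc_adj dj di ha

theorem backward {n : ℕ} (π : Equiv.Perm (Fin n)) (ha : ¬ Is321Avoiding π) :
    ∃ w w', IsReducedWord n π w ∧ IsReducedWord n π w' ∧ ¬ w.Perm w' := by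
  induction hk : invCount π using Nat.strong_induction_on generalizing π with
  | _ k ih =>
  by_cases hex : ∃ i, Desc π i ∧ ¬ Is321Avoiding (π * simpleTransposition n i)
  · obtain ⟨i, hd, hi⟩ := hex
    have := invCount_desc π hd
    obtain ⟨w, w', h1, h2, h3⟩ := ih _ (by omega) _ hi rfl
    refine ⟨_, _, red_append hd h1, red_append hd h2, ?_⟩
    rwa [List.perm_append_right_iff]
  · push Not at hex
    unfold Is321Avoiding at ha
    push Not at ha
    obtain ⟨a, b, c, hab, hbc, h1, h2⟩ := ha
    have key : ∀ i, Desc π i → (a.val = i ∧ b.val = i + 1) ∨ (b.val = i ∧ c.val = i + 1) := by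
      intro i hd
      by_contra hc
      push Not at hc
      refine hex i hd ⟨_, _, _, st_lt hd.1 hab (by tauto), st_lt hd.1 hbc (by tauto), ?_, ?_⟩
      · simpa [st_st] using h1
      · simpa [st_st] using h2
    have hab' : a.val < b.val := hab
    have hbc' : b.val < c.val := hbc
    obtain ⟨i, hi, i1, i2⟩ := exists_desc' π hab h1
    obtain ⟨j, hj, j1, j2⟩ := exists_desc' π hbc h2
    have ki := key i hi
    have kj := key j hj
    have ea : a.val = i := by omega
    have eb : b.val = i + 1 := by omega
    have ec : c.val = i + 1 + 1 := by omega
    have hj' : j = i + 1 := by omega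
    subst hj'
    have hi1 := hi.1
    have hj1 := hj.1
    have Ea : a = ⟨i, Nat.lt_of_succ_lt hi1⟩ := Fin.ext ea
    have Eb : b = ⟨i + 1, hi1⟩ := Fin.ext eb
    have Ec : c = ⟨i + 1 + 1, hj1⟩ := Fin.ext ec
    clear key hab' hbc' i1 i2 j1 j2 ki kj ea eb ec
    subst Ea Eb Ec
    have fc : simpleTransposition n i ⟨i + 1 + 1, hj1⟩ = ⟨i + 1 + 1, hj1⟩ :=
      st_fix hi1 _ (by simp; omega) (by simp)
    have fa : simpleTransposition n (i + 1) ⟨i, Nat.lt_of_succ_lt hi1⟩ = ⟨i, Nat.lt_of_succ_lt hi1⟩ :=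
      st_fix hj1 _ (by simp) (by simp; omega)
    have la := st_left hi1
    have ra := st_right hi1
    have lb := st_left hj1
    have rb := st_right hj1
    have d1 : Desc (π * simpleTransposition n i) (i + 1) := by
      refine ⟨hj1, ?_⟩
      simp only [Equiv.Perm.mul_apply, fc, ra]
      exact h2.trans h1
    have d2 : Desc (π * simpleTransposition n i * simpleTransposition n (i + 1)) i := by
      refine ⟨hi1, ?_⟩
      simp only [Equiv.Perm.mul_apply, fa, lb, fc, la]
      exact h2
    have e1 : Desc (π * simpleTransposition n (i + 1)) i := by
      refine ⟨hi1, ?_⟩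
      simp only [Equiv.Perm.mul_apply, fa, lb]
      exact h2.trans h1
    have e2 : Desc (π * simpleTransposition n (i + 1) * simpleTransposition n i) (i + 1) := by
      refine ⟨hj1, ?_⟩
      simp only [Equiv.Perm.mul_apply, fc, ra, rb, fa]
      exact h1
    obtain ⟨v, hv⟩ := exists_red (π * simpleTransposition n i * simpleTransposition n (i + 1) *
      simpleTransposition n i)
    have r1 := red_append hi (red_append d1 (red_append d2 hv))
    have hb : π * simpleTransposition n i * simpleTransposition n (i + 1) * simpleTransposition n i
      = π * simpleTransposition n (i + 1) * simpleTransposition n i *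
        simpleTransposition n (i + 1) := by
      have := congrArg (π * ·) (st_braid hj1)
      simpa only [mul_assoc] using this
    rw [hb] at hv
    have r2 := red_append hj (red_append e1 (red_append e2 hv))
    refine ⟨_, _, r1, r2, ?_⟩
    intro hp
    have := hp.count_eq i
    simp [List.count_append, List.count_cons] at this

/-- For `n ≥ 2`, a permutation `π` of `{1,…,n}` is 321-avoiding if and
only if any two reduced words for `π` are related by a finite sequence of commutation
moves (i.e. `π` has a unique reduced word up to commuting moves). -/
theorem avoiding321_iff_unique_reduced_word_up_to_comm (n : ℕ) (hn : 2 ≤ n)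
    (π : Equiv.Perm (Fin n)) :
    Is321Avoiding π ↔
      ∀ w w' : List ℕ, IsReducedWord n π w → IsReducedWord n π w' →
        Relation.ReflTransGen CommMove w w' := by
  constructor
  · intro ha w w' hw hw'
    exact forward π ha w w' hw hw'
  · intro h
    by_contra ha
    obtain ⟨w, w', h1, h2, h3⟩ := backward π ha
    exact h3 (comm_perm (h w w' h1 h2))
end

section
/- Let D be a reduced rectangular pipe dream of shape a×b. Suppose (i,j) is an elbow of D (i.e. (i,j) ∉ D), the m positions (i, j+1), …, (i, j+m) immediately to its east are all crosses, and the p positions (i+1, j), …, (i+p, j) immediately to its south are all crosses (with j+m ≤ b and i+p ≤ a). Then every position (i+r, j+s) with 1 ≤ r ≤ p and 1 ≤ s ≤ m is a cross of D. The same statement holds with east and south replaced by west and north: if (i,j) ∉ D, the positions (i, j−1), …, (i, j−m) are all in D, and the positions (i−1, j), …, (i−p, j) are all in D, then every position (i−r, j−s) with 1 ≤ r ≤ p and 1 ≤ s ≤ m is in D. -/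
/-- A rectangular pipe dream of shape `a × b`: a set of crosses `D` inside the grid
`{1,…,a} × {1,…,b}` (first coordinate = row, from top to bottom; second = column,
from left to right).  Positions of the grid not in `D` are elbows. -/
def IsPipeDream (a b : ℕ) (D : Finset (ℕ × ℕ)) : Prop :=
  D ⊆ Finset.Icc 1 a ×ˢ Finset.Icc 1 b

/-- The reading word of a rectangular pipe dream of shape `a × b`: read the rows from
bottom (`i = a`) to top (`i = 1`), each row from left (`j = 1`) to right (`j = b`);
a cross at `(i,j)` contributes the simple transposition `s_{i+j-1}` of `S_{a+b}`
(recorded here by its 0-based index `i + j - 2 = (i-1) + (j-1)`). -/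
def readingWord (a b : ℕ) (D : Finset (ℕ × ℕ)) : List ℕ :=
  ((List.range a).reverse.flatMap fun r =>
    (List.range b).filterMap fun c =>
      if (r + 1, c + 1) ∈ D then some (r + c) else none)

/-- The permutation of a rectangular pipe dream: the product of its reading word. -/
def pdPerm (a b : ℕ) (D : Finset (ℕ × ℕ)) : Equiv.Perm (Fin (a + b)) :=
  ((readingWord a b D).map (simpleTransposition (a + b))).prod

/-- A pipe dream is reduced if the Coxeter length of its permutation equals its number
of crosses. -/
def IsReducedPD (a b : ℕ) (D : Finset (ℕ × ℕ)) : Prop :=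
  invCount (pdPerm a b D) = D.card

/-- A reduced rectangular pipe dream is rigid if it is the unique reduced rectangular
pipe dream of its shape with its permutation. -/
def IsRigid (a b : ℕ) (D : Finset (ℕ × ℕ)) : Prop :=
  ∀ D' : Finset (ℕ × ℕ), IsPipeDream a b D' → IsReducedPD a b D' →
    pdPerm a b D' = pdPerm a b D → D' = D

lemma st_val_s7 (n k : ℕ) (x : Fin n) : (simpleTransposition n k x : ℕ) =
    if k + 1 < n then (if x.val = k then k + 1 else if x.val = k + 1 then k else x.val)
    else x.val := by
  unfold simpleTransposition
  by_cases h : k + 1 < n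
  · simp only [h, dite_true, if_true, Equiv.swap_apply_def, Fin.ext_iff]
    split_ifs <;> simp_all
  · simp [h]

lemma st_mono (n k : ℕ) (x y : Fin n) (hxy : x < y) (hne : ¬ (x.val = k ∧ y.val = k + 1)) :
    simpleTransposition n k x < simpleTransposition n k y := by
  rw [Fin.lt_def] at *
  rw [st_val_s7, st_val_s7]
  split_ifs <;> omega

lemma invCount_mul_st {n : ℕ} (σ : Equiv.Perm (Fin n)) (k : ℕ) :
    invCount (σ * simpleTransposition n k) ≤ invCount σ + 1 := by
  classical
  by_cases h : k + 1 < n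
  · unfold invCount
    have hinv : ∀ x, simpleTransposition n k (simpleTransposition n k x) = x := by
      intro x
      apply Fin.ext
      rw [st_val_s7, st_val_s7]
      split_ifs <;> omega
    refine le_trans (Finset.card_le_card (t := insert (⟨k, by omega⟩, ⟨k+1, h⟩)
      ((Finset.univ.filter (fun p : Fin n × Fin n => p.1 < p.2 ∧ σ p.2 < σ p.1)).image
        (fun p => (simpleTransposition n k p.1, simpleTransposition n k p.2)))) ?_) ?_
    · rintro ⟨p, q⟩ hp
      replace hp := (Finset.mem_filter.1 hp).2
      simp only [Equiv.Perm.mul_apply] at hp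
      rw [Finset.mem_insert]
      by_cases hne : p.val = k ∧ q.val = k + 1
      · left
        ext <;> simp [hne.1, hne.2]
      · right
        rw [Finset.mem_image]
        refine ⟨(simpleTransposition n k p, simpleTransposition n k q), ?_, ?_⟩
        · simp only [Finset.mem_filter, Finset.mem_univ, true_and]
          exact ⟨st_mono n k p q hp.1 hne, hp.2⟩
        · simp [hinv]
    · exact (Finset.card_insert_le _ _).trans (Nat.add_le_add_right Finset.card_image_le 1)
  · simp [simpleTransposition, h]

lemma invCount_word (n : ℕ) (w : List ℕ) :
    invCount ((w.map (simpleTransposition n)).prod) ≤ w.length := by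
  induction w using List.reverseRecOn with
  | nil =>
    simp only [List.map_nil, List.prod_nil, List.length_nil, Nat.le_zero, invCount,
      Finset.card_eq_zero, Finset.filter_eq_empty_iff]
    rintro ⟨p, q⟩ - ⟨h1, h2⟩
    simp at h1 h2
    omega
  | append_singleton w k ih =>
    simp only [List.map_append, List.prod_append, List.map_cons, List.map_nil, List.prod_cons,
      List.prod_nil, mul_one, List.length_append, List.length_singleton]
    exact (invCount_mul_st _ _).trans (by omega)

lemma word_length (a b : ℕ) (D : Finset (ℕ × ℕ)) : (readingWord a b D).length ≤ D.card := by
  classical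
  let L : List (ℕ × ℕ) := (List.range a).reverse.flatMap fun r =>
    (List.range b).filterMap fun c => if (r + 1, c + 1) ∈ D then some (r + 1, c + 1) else none
  have hL : (readingWord a b D) = L.map (fun p => p.1 + p.2 - 2) := by
    simp only [L, readingWord, List.map_flatMap, List.map_filterMap]
    congr 1
    funext r
    congr 1
    funext c
    split_ifs
    · simp; omega
    · simp
  have hmem : ∀ p ∈ L, p ∈ D := by
    intro p hp
    simp only [L, List.mem_flatMap, List.mem_filterMap] at hp
    obtain ⟨r, -, c, -, h⟩ := hp
    split_ifs at h with h'
    · simp at h; rw [← h]; exact h'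
  have hnd : L.Nodup := by
    rw [List.nodup_flatMap]
    constructor
    · intro r _
      refine List.Nodup.filterMap ?_ List.nodup_range
      intro c c' p h h'
      simp at h h'
      have := h.2.trans h'.2.symm
      simp at this
      exact this
    · refine List.Pairwise.imp ?_ (List.nodup_reverse.2 (List.nodup_range (n := a)))
      intro r r' hr p h h'
      simp only [List.mem_filterMap] at h h'
      obtain ⟨c, -, h⟩ := h
      obtain ⟨c', -, h'⟩ := h'
      simp at h h'
      have := h.2.trans h'.2.symm
      simp at this
      exact hr this.1
  rw [hL, List.length_map, ← List.toFinset_card_of_nodup hnd]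
  exact Finset.card_le_card fun p hp => hmem p (List.mem_toFinset.1 hp)

def cellP (n : ℕ) (D : Finset (ℕ × ℕ)) (r c : ℕ) : Equiv.Perm (Fin n) :=
  if (r + 1, c + 1) ∈ D then simpleTransposition n (r + c) else 1

def segP (n : ℕ) (D : Finset (ℕ × ℕ)) (r lo : ℕ) : ℕ → Equiv.Perm (Fin n)
  | 0 => 1
  | k + 1 => segP n D r lo k * cellP n D r (lo + k)

def rowsP (n : ℕ) (D : Finset (ℕ × ℕ)) (b lo : ℕ) : ℕ → Equiv.Perm (Fin n)
  | 0 => 1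
  | k + 1 => segP n D (lo + k) 0 b * rowsP n D b lo k

lemma segP_add (n : ℕ) (D : Finset (ℕ × ℕ)) (r lo k l : ℕ) :
    segP n D r lo (k + l) = segP n D r lo k * segP n D r (lo + k) l := by
  induction l with
  | zero => simp [segP]
  | succ l ih => rw [← add_assoc, segP, ih, segP, mul_assoc, add_assoc]

lemma rowsP_add (n : ℕ) (D : Finset (ℕ × ℕ)) (b lo k l : ℕ) :
    rowsP n D b lo (k + l) = rowsP n D b (lo + k) l * rowsP n D b lo k := by
  induction l with
  | zero => simp [rowsP]
  | succ l ih => rw [← add_assoc, rowsP, ih, rowsP, mul_assoc, add_assoc]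

lemma seg_eq (n b r : ℕ) (D : Finset (ℕ × ℕ)) :
    (((List.range b).filterMap fun c =>
      if (r + 1, c + 1) ∈ D then some (r + c) else none).map (simpleTransposition n)).prod
      = segP n D r 0 b := by
  induction b with
  | zero => simp [segP]
  | succ b ih =>
    rw [List.range_succ, List.filterMap_append, List.map_append, List.prod_append, ih, segP]
    congr 1
    by_cases h : (r + 1, b + 1) ∈ D <;> simp [cellP, h]

lemma pdPerm_eq (a b : ℕ) (D : Finset (ℕ × ℕ)) : pdPerm a b D = rowsP (a + b) D b 0 a := by
  unfold pdPerm readingWord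
  generalize a + b = n
  induction a with
  | zero => simp [rowsP]
  | succ a ih =>
    rw [List.range_succ, List.reverse_append, List.reverse_singleton, List.singleton_append,
      List.flatMap_cons, List.map_append, List.prod_append, ih, seg_eq, rowsP, zero_add]

lemma segP_split (n : ℕ) (D : Finset (ℕ × ℕ)) (r lo c b : ℕ) (h1 : lo ≤ c) (h2 : c < lo + b) :
    segP n D r lo b = segP n D r lo (c - lo) * cellP n D r c * segP n D r (c + 1) (lo + b - c - 1) := by
  obtain ⟨k, rfl⟩ := Nat.exists_eq_add_of_le h1
  obtain ⟨l, rfl⟩ : ∃ l, b = k + 1 + l := ⟨b - k - 1, by omega⟩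
  rw [segP_add, segP]
  congr 2
  · simp
  · omega

lemma cellP_fix (n : ℕ) (D : Finset (ℕ × ℕ)) (r c : ℕ) (x : Fin n) (h1 : x.val ≠ r + c)
    (h2 : x.val ≠ r + c + 1) : cellP n D r c x = x := by
  unfold cellP
  split_ifs
  · apply Fin.ext; rw [st_val_s7]; simp [h1, h2]
  · rfl

lemma segP_fix (n : ℕ) (D : Finset (ℕ × ℕ)) (r lo k : ℕ) (x : Fin n)
    (h : x.val < r + lo ∨ r + lo + k < x.val) : segP n D r lo k x = x := by
  induction k with
  | zero => rfl
  | succ k ih =>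
    rw [segP, Equiv.Perm.mul_apply, cellP_fix _ _ _ _ _ (by omega) (by omega)]
    exact ih (by omega)

lemma segP_run (n : ℕ) (D : Finset (ℕ × ℕ)) (r lo k : ℕ) (x : Fin n)
    (hD : ∀ c, lo ≤ c → c < lo + k → (r + 1, c + 1) ∈ D)
    (h : x.val = r + lo + k) : (segP n D r lo k x).val = r + lo := by
  induction k generalizing x with
  | zero => simpa [segP] using h
  | succ k ih =>
    rw [segP, Equiv.Perm.mul_apply]
    apply ih
    · intro c h1 h2; exact hD c h1 (by omega)
    · rw [cellP, if_pos (hD _ (by omega) (by omega)), st_val_s7]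
      have := x.isLt
      split_ifs <;> omega

lemma row_vert (n : ℕ) (D : Finset (ℕ × ℕ)) (r c b : ℕ) (x : Fin n) (hc : c < b)
    (hD : (r + 1, c + 1) ∈ D) (hn : r + c + 1 < n) (h : x.val = r + c) :
    (segP n D r 0 b x).val = r + c + 1 := by
  rw [segP_split n D r 0 c b (by omega) (by omega), Equiv.Perm.mul_apply, Equiv.Perm.mul_apply,
    segP_fix n D r (c + 1) _ x (by omega)]
  have : (cellP n D r c x).val = r + c + 1 := by
    rw [cellP, if_pos hD, st_val_s7]; simp [hn, h]
  rw [segP_fix _ _ _ _ _ _ (by omega : _ ∨ _), this]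

lemma rows_vert (n : ℕ) (D : Finset (ℕ × ℕ)) (lo k c b : ℕ) (x : Fin n) (hc : c < b)
    (hD : ∀ r, lo ≤ r → r < lo + k → (r + 1, c + 1) ∈ D) (hn : lo + k + c < n)
    (h : x.val = lo + c) :
    (rowsP n D b lo k x).val = lo + k + c := by
  induction k with
  | zero => simpa [rowsP] using h
  | succ k ih =>
    rw [rowsP, Equiv.Perm.mul_apply, row_vert n D (lo + k) c b _ hc
      (hD _ (by omega) (by omega)) (by omega)]
    · omega
    · exact ih (fun r h1 h2 => hD r h1 (by omega)) (by omega)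

lemma segP_congr (n : ℕ) (D E : Finset (ℕ × ℕ)) (r lo k : ℕ)
    (h : ∀ c, lo ≤ c → c < lo + k → ((r + 1, c + 1) ∈ D ↔ (r + 1, c + 1) ∈ E)) :
    segP n D r lo k = segP n E r lo k := by
  induction k with
  | zero => rfl
  | succ k ih =>
    rw [segP, segP, ih (fun c h1 h2 => h c h1 (by omega)), cellP, cellP]
    simp only [h (lo + k) (by omega) (by omega)]

lemma rowsP_congr (n : ℕ) (D E : Finset (ℕ × ℕ)) (b lo k : ℕ)
    (h : ∀ r c, lo ≤ r → r < lo + k → ((r + 1, c + 1) ∈ D ↔ (r + 1, c + 1) ∈ E)) :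
    rowsP n D b lo k = rowsP n E b lo k := by
  induction k with
  | zero => rfl
  | succ k ih =>
    rw [rowsP, rowsP, ih (fun r c h1 h2 => h r c h1 (by omega)),
      segP_congr n D E _ _ _ (fun c _ _ => h _ c (by omega) (by omega))]

lemma rows_decomp (n : ℕ) (D : Finset (ℕ × ℕ)) (a b i j r s : ℕ) (hi : i + (r + 1) < a)
    (hj : j + (s + 1) < b) :
    rowsP n D b 0 a = (rowsP n D b (i + (r + 1) + 1) (a - (i + (r + 1) + 1)) *
        segP n D (i + (r + 1)) 0 j) * cellP n D (i + (r + 1)) j *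
      (segP n D (i + (r + 1)) (j + 1) (b - j - 1) * rowsP n D b (i + 1) r *
        segP n D i 0 (j + (s + 1))) * cellP n D i (j + (s + 1)) *
      (segP n D i (j + (s + 1) + 1) (b - (j + (s + 1)) - 1) * rowsP n D b 0 i) := by
  obtain ⟨l, rfl⟩ : ∃ l, a = i + 1 + (r + 1) + l := ⟨a - (i + 1 + (r + 1)), by omega⟩
  rw [rowsP_add, rowsP_add, rowsP, rowsP,
    segP_split n D _ 0 j b (by omega) (by omega),
    segP_split n D (0 + i) 0 (j + (s + 1)) b (by omega) (by omega)]
  have e1 : 0 + (i + 1 + (r + 1)) = i + (r + 1) + 1 := by omega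
  have e2 : i + 1 + r = i + (r + 1) := by omega
  have e3 : i + 1 + (r + 1) + l - (i + (r + 1) + 1) = l := by omega
  simp only [e1, e2, e3, zero_add, Nat.sub_zero, mul_assoc]

/-- 0-based core: a rectangle with elbow NW and SE corners and crosses on the rest of the
boundary is impossible. -/
lemma core (a b : ℕ) (D : Finset (ℕ × ℕ)) (hred : IsReducedPD a b D) (i j r s : ℕ)
    (hi : i + (r + 1) < a) (hj : j + (s + 1) < b)
    (hNW : (i + 1, j + 1) ∉ D) (hSE : (i + (r + 1) + 1, j + (s + 1) + 1) ∉ D)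
    (hN : ∀ c, j < c → c ≤ j + (s + 1) → (i + 1, c + 1) ∈ D)
    (hW : ∀ k, i < k → k ≤ i + (r + 1) → (k + 1, j + 1) ∈ D)
    (hS : ∀ c, j < c → c < j + (s + 1) → (i + (r + 1) + 1, c + 1) ∈ D)
    (hE : ∀ k, i < k → k < i + (r + 1) → (k + 1, j + (s + 1) + 1) ∈ D) : False := by
  classical
  set n := a + b with hn
  set B := segP n D (i + (r + 1)) (j + 1) (b - j - 1) * rowsP n D b (i + 1) r *
        segP n D i 0 (j + (s + 1)) with hB
  have hB1 : ∀ x : Fin n, x.val = i + (j + (s + 1)) → (B x).val = i + (r + 1) + j := by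
    intro x hx
    have h1 : (segP n D i 0 (j + (s + 1)) x).val = i + 1 + j := by
      rw [segP_split n D i 0 j (j + (s + 1)) (by omega) (by omega), Equiv.Perm.mul_apply,
        Equiv.Perm.mul_apply]
      have := segP_run n D i (j + 1) (0 + (j + (s + 1)) - j - 1) x
        (fun c h1 h2 => hN c (by omega) (by omega)) (by omega)
      have e : cellP n D i j = 1 := by simp [cellP, hNW]
      rw [e, Equiv.Perm.one_apply, segP_fix _ _ _ _ _ _ (by omega : _ ∨ _), this]
      omega
    have h2 := rows_vert n D (i + 1) r j b _ (by omega)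
      (fun k h1 h2 => hW k (by omega) (by omega)) (by omega) h1
    rw [hB, Equiv.Perm.mul_apply, Equiv.Perm.mul_apply, segP_fix _ _ _ _ _ _ (by omega : _ ∨ _), h2]
    omega
  have hB2 : ∀ x : Fin n, x.val = i + (j + (s + 1)) + 1 → (B x).val = i + (r + 1) + j + 1 := by
    intro x hx
    have h1 : (segP n D i 0 (j + (s + 1)) x).val = i + 1 + (j + (s + 1)) := by
      rw [segP_fix _ _ _ _ _ _ (by omega : _ ∨ _)]; omega
    have h2 := rows_vert n D (i + 1) r (j + (s + 1)) b _ (by omega)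
      (fun k h1 h2 => hE k (by omega) (by omega)) (by omega) h1
    rw [hB, Equiv.Perm.mul_apply, Equiv.Perm.mul_apply,
      segP_split n D (i + (r + 1)) (j + 1) (j + (s + 1)) _ (by omega) (by omega),
      Equiv.Perm.mul_apply, Equiv.Perm.mul_apply]
    have e : cellP n D (i + (r + 1)) (j + (s + 1)) = 1 := by simp [cellP, hSE]
    rw [e, Equiv.Perm.one_apply, segP_fix n D _ (j + (s + 1) + 1) _ _ (by omega)]
    rw [segP_run n D (i + (r + 1)) (j + 1) _ _ (fun c h1 h2 => hS c (by omega) (by omega))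
      (by omega)]
    omega
  have hcomm : simpleTransposition n (i + (r + 1) + j) * B *
      simpleTransposition n (i + (j + (s + 1))) = B := by
    have l1 : i + (r + 1) + j + 1 < n := by omega
    have l2 : i + (j + (s + 1)) + 1 < n := by omega
    rw [mul_assoc]
    unfold simpleTransposition
    rw [dif_pos l1, dif_pos l2, Equiv.mul_swap_eq_swap_mul]
    have e1 : B ⟨i + (j + (s + 1)), Nat.lt_of_succ_lt l2⟩
      = ⟨i + (r + 1) + j, Nat.lt_of_succ_lt l1⟩ := Fin.ext (hB1 _ rfl)
    have e2 : B ⟨i + (j + (s + 1)) + 1, l2⟩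
      = ⟨i + (r + 1) + j + 1, l1⟩ := Fin.ext (hB2 _ rfl)
    rw [e1, e2, ← mul_assoc, Equiv.swap_mul_self, one_mul]
  set E := (D.erase (i + (r + 1) + 1, j + 1)).erase (i + 1, j + (s + 1) + 1) with hE'
  have m1 : (i + (r + 1) + 1, j + 1) ∈ D := hW _ (by omega) (by omega)
  have m2 : (i + 1, j + (s + 1) + 1) ∈ D := hN _ (by omega) (by omega)
  have hmem : ∀ k c, ¬ (k = i + (r + 1) ∧ c = j) → ¬ (k = i ∧ c = j + (s + 1)) →
      ((k + 1, c + 1) ∈ D ↔ (k + 1, c + 1) ∈ E) := by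
    intro k c h1 h2
    simp only [hE', Finset.mem_erase, ne_eq, Prod.mk.injEq, Nat.add_right_cancel_iff]
    tauto
  have hperm : pdPerm a b D = pdPerm a b E := by
    rw [pdPerm_eq, pdPerm_eq, ← hn, rows_decomp n D a b i j r s hi hj,
      rows_decomp n E a b i j r s hi hj]
    rw [← hB]
    have c1 : cellP n D (i + (r + 1)) j = simpleTransposition n (i + (r + 1) + j) := by
      rw [cellP, if_pos m1]
    have c2 : cellP n D i (j + (s + 1)) = simpleTransposition n (i + (j + (s + 1))) := by
      rw [cellP, if_pos m2]
    have c3 : cellP n E (i + (r + 1)) j = 1 := by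
      rw [cellP, if_neg]; simp [hE']
    have c4 : cellP n E i (j + (s + 1)) = 1 := by
      rw [cellP, if_neg]; simp [hE']
    rw [c1, c2, c3, c4, mul_one, mul_one]
    rw [← rowsP_congr n D E b (i + (r + 1) + 1) _ (fun k c h1 h2 => hmem k c (by omega) (by omega)),
      ← rowsP_congr n D E b (i + 1) _ (fun k c h1 h2 => hmem k c (by omega) (by omega)),
      ← rowsP_congr n D E b 0 i (fun k c h1 h2 => hmem k c (by omega) (by omega)),
      ← segP_congr n D E _ 0 j (fun c h1 h2 => hmem _ c (by omega) (by omega)),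
      ← segP_congr n D E _ (j + 1) _ (fun c h1 h2 => hmem _ c (by omega) (by omega)),
      ← segP_congr n D E i 0 (j + (s + 1)) (fun c h1 h2 => hmem _ c (by omega) (by omega)),
      ← segP_congr n D E i (j + (s + 1) + 1) _ (fun c h1 h2 => hmem _ c (by omega) (by omega)),
      ← hB]
    generalize rowsP n D b (i + (r + 1) + 1) (a - (i + (r + 1) + 1)) *
        segP n D (i + (r + 1)) 0 j = A
    rw [mul_assoc A, mul_assoc A, hcomm]
  have hle : invCount (pdPerm a b E) ≤ E.card :=
    (invCount_word _ _).trans (word_length a b E)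
  rw [← hperm, hred] at hle
  have h1 : E.card ≤ (D.erase (i + (r + 1) + 1, j + 1)).card := Finset.card_le_card (Finset.erase_subset _ _)
  have h2 := Finset.card_erase_lt_of_mem m1
  omega

/-- 1-based version. -/
lemma core' (a b : ℕ) (D : Finset (ℕ × ℕ)) (hred : IsReducedPD a b D) (i j i' j' : ℕ)
    (hi : 1 ≤ i) (hj : 1 ≤ j) (hii : i < i') (hjj : j < j') (hi' : i' ≤ a) (hj' : j' ≤ b)
    (hNW : (i, j) ∉ D) (hSE : (i', j') ∉ D)
    (hN : ∀ c, j < c → c ≤ j' → (i, c) ∈ D)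
    (hW : ∀ k, i < k → k ≤ i' → (k, j) ∈ D)
    (hS : ∀ c, j < c → c < j' → (i', c) ∈ D)
    (hE : ∀ k, i < k → k < i' → (k, j') ∈ D) : False := by
  obtain ⟨i, rfl⟩ : ∃ k, i = k + 1 := ⟨i - 1, by omega⟩
  obtain ⟨j, rfl⟩ : ∃ k, j = k + 1 := ⟨j - 1, by omega⟩
  obtain ⟨r, rfl⟩ : ∃ k, i' = i + (k + 1) + 1 := ⟨i' - i - 2, by omega⟩
  obtain ⟨s, rfl⟩ : ∃ k, j' = j + (k + 1) + 1 := ⟨j' - j - 2, by omega⟩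
  exact core a b D hred i j r s (by omega) (by omega) hNW hSE
    (fun c h1 h2 => hN _ (by omega) (by omega)) (fun c h1 h2 => hW _ (by omega) (by omega))
    (fun c h1 h2 => hS _ (by omega) (by omega)) (fun c h1 h2 => hE _ (by omega) (by omega))

/-- In a reduced rectangular pipe dream `D` of shape `a × b`, if `(i,j)`
is an elbow, the `m` positions `(i, j+1), …, (i, j+m)` to its east are crosses, and the
`p` positions `(i+1, j), …, (i+p, j)` to its south are crosses, then the whole
`p × m` box `{(i+r, j+s) : 1 ≤ r ≤ p, 1 ≤ s ≤ m}` consists of crosses.  The same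
holds with east and south replaced by west and north. -/
theorem fillin_rectangle (a b : ℕ) (D : Finset (ℕ × ℕ))
    (hpd : IsPipeDream a b D) (hred : IsReducedPD a b D) :
    (∀ i j m p : ℕ, 1 ≤ i → i + p ≤ a → 1 ≤ j → j + m ≤ b →
      (i, j) ∉ D →
      (∀ s, 1 ≤ s → s ≤ m → (i, j + s) ∈ D) →
      (∀ r, 1 ≤ r → r ≤ p → (i + r, j) ∈ D) →
      ∀ r s, 1 ≤ r → r ≤ p → 1 ≤ s → s ≤ m → (i + r, j + s) ∈ D) ∧
    (∀ i j m p : ℕ, p < i → i ≤ a → m < j → j ≤ b →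
      (i, j) ∉ D →
      (∀ s, 1 ≤ s → s ≤ m → (i, j - s) ∈ D) →
      (∀ r, 1 ≤ r → r ≤ p → (i - r, j) ∈ D) →
      ∀ r s, 1 ≤ r → r ≤ p → 1 ≤ s → s ≤ m → (i - r, j - s) ∈ D) := by
  constructor
  · intro i j m p hi hp hj hm hel hs hr r
    induction r using Nat.strong_induction_on with
    | _ r ihr =>
      intro s
      induction s using Nat.strong_induction_on with
      | _ s ihs =>
        intro h1 h2 h3 h4
        by_contra hcon
        refine core' a b D hred i j (i + r) (j + s) hi hj (by omega) (by omega) (by omega)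
          (by omega) hel hcon ?_ ?_ ?_ ?_
        · intro c g1 g2
          have := hs (c - j) (by omega) (by omega)
          rwa [Nat.add_sub_cancel' (by omega)] at this
        · intro c g1 g2
          have := hr (c - i) (by omega) (by omega)
          rwa [Nat.add_sub_cancel' (by omega)] at this
        · intro c g1 g2
          have := ihs (c - j) (by omega) h1 h2 (by omega) (by omega)
          rwa [Nat.add_sub_cancel' (by omega)] at this
        · intro c g1 g2
          have := ihr (c - i) (by omega) s (by omega) (by omega) h3 h4
          rwa [Nat.add_sub_cancel' (by omega)] at this
  · intro i j m p hi hp hj hm hel hs hr r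
    induction r using Nat.strong_induction_on with
    | _ r ihr =>
      intro s
      induction s using Nat.strong_induction_on with
      | _ s ihs =>
        intro h1 h2 h3 h4
        by_contra hcon
        refine core' a b D hred (i - r) (j - s) i j (by omega) (by omega) (by omega) (by omega)
          (by omega) (by omega) hcon hel ?_ ?_ ?_ ?_
        · intro c g1 g2
          rcases Nat.eq_or_lt_of_le g2 with rfl | g3
          · exact hr r h1 h2
          have := ihs (j - c) (by omega) h1 h2 (by omega) (by omega)
          rwa [Nat.sub_sub_self (by omega)] at this
        · intro c g1 g2
          rcases Nat.eq_or_lt_of_le g2 with rfl | g3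
          · exact hs s h3 h4
          have := ihr (i - c) (by omega) s (by omega) (by omega) h3 h4
          rwa [Nat.sub_sub_self (by omega)] at this
        · intro c g1 g2
          have := hs (j - c) (by omega) (by omega)
          rwa [Nat.sub_sub_self (by omega)] at this
        · intro c g1 g2
          have := hr (i - c) (by omega) (by omega)
          rwa [Nat.sub_sub_self (by omega)] at this
end
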